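/- arXiv:1705.03842 — 3 statements merged into one kernel-verified Lean document; each statement's English description precedes it below -/
import Mathlib

section
/- Let K be a field of characteristic 0 and Σ_{i=0}^{k} P_i(x) f^{(i)}(x) = 0 a linear differential equation with polynomial coefficients satisfying P_0 ≠ 0. Let I = {i : P_i ≠ 0}. If the pairwise distinct shifted powers (x-a_1)^{e_1}, ..., (x-a_s)^{e_s} all satisfy the equation, then Π_{i=1}^{s} (x - a_i) divides Π_{i ∈ I} P_i. -/
open Polynomial
open scoped Classical

/-- A divided difference: a linear functional supported on `E` that picks out the last of the
consecutive falling factorials of orders `m, …, m + d`. -/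
lemma exists_weights_descFactorial (K : Type*) [Field K] [CharZero K] {m d : ℕ} {E : Finset ℕ}
    (hE : E.card = d + 1) (hm : ∀ n ∈ E, m ≤ n) :
    ∃ μ : ℕ → K, ∀ c, m ≤ c → c ≤ m + d →
      ∑ n ∈ E, μ n * (n.descFactorial c : K) = if c = m + d then 1 else 0 := by
  set v : ℕ → K := fun n => ((n - m : ℕ) : K) with hv
  have hinj : Set.InjOn v E := by
    intro x hx y hy hxy
    have h : x - m = y - m := Nat.cast_injective hxy
    have := hm x hx
    have := hm y hy
    omega
  refine ⟨fun n => ((n.descFactorial m : K) * ∏ j ∈ E.erase n, (v n - v j))⁻¹,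
    fun c hmc hcd => ?_⟩
  have hdeg : (descPochhammer K (c - m)).degree < E.card := by
    rw [degree_eq_natDegree (monic_descPochhammer K _).ne_zero, descPochhammer_natDegree, hE]
    exact_mod_cast (by omega : c - m < d + 1)
  have hcoeff : (descPochhammer K (c - m)).coeff d = if c = m + d then 1 else 0 := by
    split_ifs with h
    · have h1 := (monic_descPochhammer K (c - m)).coeff_natDegree
      rw [descPochhammer_natDegree] at h1
      rwa [show c - m = d by omega] at h1 ⊢
    · exact coeff_eq_zero_of_natDegree_lt (by rw [descPochhammer_natDegree]; omega)
  have hsum := Lagrange.coeff_eq_sum hinj hdeg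
  rw [hE, Nat.add_sub_cancel, hcoeff] at hsum
  rw [hsum]
  refine Finset.sum_congr rfl fun n hn => ?_
  have hpos : (n.descFactorial m : K) ≠ 0 := by
    rw [Nat.cast_ne_zero, Ne, Nat.descFactorial_eq_zero_iff_lt]
    exact (hm n hn).not_gt
  rw [← Nat.descFactorial_mul_descFactorial hmc, hv, descPochhammer_eval_eq_descFactorial]
  push_cast
  rw [mul_inv, div_eq_mul_inv]
  field_simp

lemma X_sub_C_pow_card_dvd {K : Type*} [Field K] [CharZero K] (P : ℕ → K[X]) (a : K) (j : ℕ)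
    (E : Finset ℕ) (hj : ∀ n ∈ E, j ≤ n)
    (hsol : ∀ n ∈ E, ∑ c ∈ Finset.range (j + 1), P c * derivative^[c] ((X - C a) ^ n) = 0) :
    (X - C a) ^ E.card ∣ P j := by
  rcases Nat.eq_zero_or_pos E.card with h0 | hpos
  · simp [h0]
  have hred : ∀ n ∈ E, ∑ c ∈ Finset.range (j + 1),
      C (n.descFactorial c : K) * (P c * (X - C a) ^ (j - c)) = 0 := by
    intro n hn
    have hy : (X - C a) ^ (n - j) ≠ 0 := pow_ne_zero _ (X_sub_C_ne_zero a)
    refine (mul_eq_zero.mp ?_).resolve_left hy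
    rw [← hsol n hn, Finset.mul_sum]
    refine Finset.sum_congr rfl fun c hc => ?_
    have hcj := Finset.mem_range.mp hc
    have hnj := hj n hn
    rw [iterate_derivative_X_sub_pow, show n - c = (n - j) + (j - c) by omega, pow_add,
      nsmul_eq_mul, C_eq_natCast]
    ring
  obtain ⟨d, hd⟩ : ∃ d, d = min (E.card - 1) j := ⟨_, rfl⟩
  obtain ⟨E', hE', hcard⟩ := Finset.exists_subset_card_eq (show d + 1 ≤ E.card by omega)
  obtain ⟨μ, hμ⟩ := exists_weights_descFactorial K (m := j - d) hcard
    fun n hn => (Nat.sub_le j d).trans (hj n (hE' hn))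
  rw [show j - d + d = j by omega] at hμ
  have hcomb : ∑ c ∈ Finset.range (j + 1),
      C (∑ n ∈ E', μ n * (n.descFactorial c : K)) * (P c * (X - C a) ^ (j - c)) = 0 := by
    simp_rw [map_sum, Finset.sum_mul, C_mul, mul_assoc]
    rw [Finset.sum_comm]
    refine Finset.sum_eq_zero fun n hn => ?_
    rw [← Finset.mul_sum, hred n (hE' hn), mul_zero]
  rw [Finset.sum_range_succ, hμ j (Nat.sub_le j d) le_rfl, if_pos rfl] at hcomb
  simp only [map_one, Nat.sub_self, pow_zero, one_mul, mul_one] at hcomb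
  rw [eq_neg_of_add_eq_zero_right hcomb, dvd_neg]
  refine Finset.dvd_sum fun c hc => ?_
  have hcj := Finset.mem_range.mp hc
  by_cases hcd : j - d ≤ c
  · rw [hμ c hcd hcj.le, if_neg hcj.ne]
    simp
  · exact ((pow_dvd_pow _ (by omega)).mul_left _).mul_left _

theorem stmt6 (K : Type*) [Field K] [CharZero K] (k s : ℕ)
    (P : ℕ → Polynomial K) (hP0 : P 0 ≠ 0)
    (a : Fin s → K) (e : Fin s → ℕ)
    (hdist : Function.Injective (fun i => (a i, e i)))
    (hsol : ∀ i : Fin s,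
      ∑ j ∈ Finset.range (k + 1), P j * derivative^[j] ((X - C (a i)) ^ (e i)) = 0) :
    (∏ i : Fin s, (X - C (a i))) ∣
      ∏ j ∈ (Finset.range (k + 1)).filter (fun j => P j ≠ 0), P j := by
  set top : Fin s → ℕ := fun i => Nat.findGreatest (fun j => P j ≠ 0) (min k (e i))
  have htop_le : ∀ i, top i ≤ min k (e i) := fun i => Nat.findGreatest_le _
  have htop_ne : ∀ i, P (top i) ≠ 0 := fun i =>
    Nat.findGreatest_spec (P := fun j => P j ≠ 0) (Nat.zero_le _) hP0
  have hmaps : ∀ i ∈ (Finset.univ : Finset (Fin s)),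
      top i ∈ (Finset.range (k + 1)).filter (fun j => P j ≠ 0) := fun i _ => by
    rw [Finset.mem_filter, Finset.mem_range]
    exact ⟨by have := htop_le i; omega, htop_ne i⟩
  have htrunc : ∀ i, ∑ c ∈ Finset.range (top i + 1),
      P c * derivative^[c] ((X - C (a i)) ^ (e i)) = 0 := by
    intro i
    have hi := htop_le i
    rw [← hsol i]
    refine Finset.sum_subset (Finset.range_subset_range.mpr (by omega)) fun c hc hc' => ?_
    rw [Finset.mem_range] at hc hc'
    rcases le_or_gt c (e i) with hce | hce
    · have hPc : P c = 0 := not_not.mp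
        (Nat.findGreatest_is_greatest (P := fun j => P j ≠ 0) (n := min k (e i))
          (show top i < c by omega) (by omega))
      rw [hPc, zero_mul]
    · rw [iterate_derivative_X_sub_pow, Nat.descFactorial_of_lt hce, zero_smul, mul_zero]
  rw [← Finset.prod_fiberwise_of_maps_to hmaps]
  refine Finset.prod_dvd_prod_of_dvd _ _ fun j _ => ?_
  rw [Finset.prod_comp (fun b => X - C b) a]
  refine Finset.prod_dvd_of_coprime (fun b _ b' _ hbb' => ?_) fun b _ => ?_
  · exact (pairwise_coprime_X_sub_C Function.injective_id hbb').pow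
  · have hinj : Set.InjOn e
        (((Finset.univ.filter fun i => top i = j).filter fun i => a i = b : Finset (Fin s)) :
          Set (Fin s)) := by
      intro x hx y hy hxy
      simp only [Finset.coe_filter, Finset.mem_filter, Set.mem_ofPred_eq] at hx hy
      exact hdist (Prod.ext (hx.2.trans hy.2.symm) hxy)
    rw [← Finset.card_image_of_injOn hinj]
    refine X_sub_C_pow_card_dvd P b j _ ?_ ?_ <;>
    · simp only [Finset.mem_image, Finset.mem_filter, Finset.mem_univ, true_and]
      rintro _ ⟨i, ⟨rfl, rfl⟩, rfl⟩
      first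
        | exact (htop_le i).trans (min_le_right _ _)
        | exact htrunc i
end

section
/- Let F = {(x - a_i)^{e_i} : 1 ≤ i ≤ s} be a family of pairwise distinct shifted powers with real a_i and exponents e_i ≥ max(1, 2s - 4) for all i. Then the elements of F are linearly independent over ℝ. -/
open Polynomial

/-- `f` takes values of strict signs `σ, -σ, σ, …` at `n` successive points to the right of `t`. -/
def AlternatesFrom (f : ℝ → ℝ) : ℕ → ℝ → ℝ → Prop
  | 0, _, _ => True
  | n + 1, σ, t => ∃ x, t ≤ x ∧ 0 < σ * f x ∧ AlternatesFrom f n (-σ) x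

/-- Starting at `t`, `f` makes `n` successive moves, in the directions `σ, -σ, σ, …`. -/
def OscillatesFrom (f : ℝ → ℝ) : ℕ → ℝ → ℝ → Prop
  | 0, _, _ => True
  | n + 1, σ, t => ∃ x, t ≤ x ∧ 0 < σ * (f x - f t) ∧ OscillatesFrom f n (-σ) x

namespace AlternatesFrom

variable {f : ℝ → ℝ} {m n : ℕ} {σ t u : ℝ}

theorem of_le (h : AlternatesFrom f n σ t) (hu : u ≤ t) : AlternatesFrom f n σ u := by
  cases n with
  | zero => trivial
  | succ n =>
    obtain ⟨x, hx, h⟩ := h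
    exact ⟨x, hu.trans hx, h⟩

theorem anti (hmn : m ≤ n) (h : AlternatesFrom f n σ t) : AlternatesFrom f m σ t := by
  induction n generalizing m σ t with
  | zero => obtain rfl : m = 0 := by omega
            trivial
  | succ n ih =>
    cases m with
    | zero => trivial
    | succ m =>
      obtain ⟨x, hx, hpos, h⟩ := h
      exact ⟨x, hx, hpos, ih (by omega) h⟩

/-- If `f` vanishes at arbitrarily large arguments, it makes a last move towards zero. -/
theorem oscillatesFrom_of_neg (hf : ∀ t, ∃ x, t ≤ x ∧ f x = 0) (ht : σ * f t < 0)
    (h : AlternatesFrom f n σ t) : OscillatesFrom f (n + 1) σ t := by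
  induction n generalizing σ t with
  | zero =>
    obtain ⟨x, hx, h0⟩ := hf t
    exact ⟨x, hx, by rw [h0]; linarith, trivial⟩
  | succ n ih =>
    obtain ⟨x, hx, hpos, h⟩ := h
    exact ⟨x, hx, by linarith, ih (by linarith) h⟩

theorem oscillatesFrom_of_eq_zero (hf : ∀ t, ∃ x, t ≤ x ∧ f x = 0) (ht : f t = 0)
    (h : AlternatesFrom f (n + 1) σ t) : OscillatesFrom f (n + 2) σ t := by
  obtain ⟨x, hx, hpos, h⟩ := h
  exact ⟨x, hx, by rw [ht]; linarith, h.oscillatesFrom_of_neg hf (by linarith)⟩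

end AlternatesFrom

section TruncatedPowers

variable {ι : Type*} (I : Finset ι) (a : ι → ℝ) (e : ι → ℕ) (c : ι → ℝ)

/-- The `m`-th right derivative of the spline `∑ i ∈ I, c i * (x - a i)₊ ^ e i`. -/
noncomputable def truncSum (m : ℕ) (x : ℝ) : ℝ :=
  ∑ i ∈ I, if a i ≤ x then c i * (e i).descFactorial m * (x - a i) ^ (e i - m) else 0

/-- The indices whose truncated power has a jump to the right of `y` after `m` derivatives. -/
noncomputable def jumpsAfter (m : ℕ) (y : ℝ) : Finset ι := {i ∈ I | e i = m ∧ y < a i}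

variable {I a e c} {m n : ℕ} {σ t y z : ℝ}

theorem hasDerivWithinAt_truncSum (m : ℕ) (x : ℝ) :
    HasDerivWithinAt (truncSum I a e c m) (truncSum I a e c (m + 1) x) (Set.Ici x) x := by
  unfold truncSum
  refine HasDerivWithinAt.fun_sum fun i _ => ?_
  by_cases h : a i ≤ x
  · rw [if_pos h]
    have key : HasDerivWithinAt
        (fun y => c i * (e i).descFactorial m * (y - a i) ^ (e i - m))
        (c i * (e i).descFactorial (m + 1) * (x - a i) ^ (e i - (m + 1))) (Set.Ici x) x := by
      have h1 := ((((hasDerivAt_id x).sub_const (a i)).pow (e i - m)).const_mul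
        (c i * (e i).descFactorial m)).hasDerivWithinAt (s := Set.Ici x)
      refine h1.congr_deriv ?_
      rw [Nat.descFactorial_succ, ← Nat.sub_sub]
      push_cast
      simp only [id]
      ring
    exact key.congr (fun y hy => if_pos (h.trans hy)) (if_pos h)
  · rw [if_neg h]
    have hev : (fun y => if a i ≤ y then c i * (e i).descFactorial m * (y - a i) ^ (e i - m)
        else 0) =ᶠ[nhds x] fun _ => (0 : ℝ) := by
      filter_upwards [Iio_mem_nhds (not_le.mp h)] with y hy
      exact if_neg (not_le.mpr hy)
    exact ((hasDerivAt_const x (0 : ℝ)).congr_of_eventuallyEq hev).hasDerivWithinAt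

theorem continuousOn_truncSum (h : ∀ i ∈ I, e i = m → y < a i → z < a i) :
    ContinuousOn (truncSum I a e c m) (Set.Icc y z) := by
  unfold truncSum
  refine continuousOn_finsetSum _ fun i hi => ?_
  rcases lt_trichotomy (e i) m with hlt | heq | hgt
  · simp only [Nat.descFactorial_of_lt hlt, Nat.cast_zero, mul_zero, zero_mul, ite_self]
    exact continuousOn_const
  · by_cases hy : a i ≤ y
    · refine (continuousOn_const (c := c i * (e i).descFactorial m)).congr fun x hx => ?_
      simp [hy.trans hx.1, heq]
    · have hz := h i hi heq (not_le.mp hy)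
      refine (continuousOn_const (c := (0 : ℝ))).congr fun x hx => ?_
      exact if_neg (not_le.mpr (hx.2.trans_lt hz))
  · have hne : e i - m ≠ 0 := by omega
    refine Continuous.continuousOn ?_
    refine (continuous_const.mul (((continuous_id.sub continuous_const).pow _))).if_le
      continuous_const continuous_const continuous_id fun x hx => ?_
    simp [← hx, hne]

theorem exists_pos_truncSum_succ (hyz : y ≤ z)
    (h : 0 < σ * (truncSum I a e c m z - truncSum I a e c m y))
    (hjump : ∀ i ∈ I, e i = m → y < a i → z < a i) :
    ∃ x, y ≤ x ∧ x ≤ z ∧ 0 < σ * truncSum I a e c (m + 1) x := by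
  by_contra! hcon
  have := image_le_of_deriv_right_le_deriv_boundary
    (f := fun x => σ * truncSum I a e c m x) (f' := fun x => σ * truncSum I a e c (m + 1) x)
    (B := fun _ => σ * truncSum I a e c m y) (B' := fun _ => 0)
    (continuousOn_const.mul (continuousOn_truncSum hjump))
    (fun x _ => (hasDerivWithinAt_truncSum m x).const_mul σ) le_rfl continuousOn_const
    (fun x _ => hasDerivWithinAt_const _ _ _) (fun x hx => hcon x hx.1 hx.2.le)
    (Set.right_mem_Icc.mpr hyz)
  linarith

theorem jumpsAfter_subset (hyz : y ≤ z) : jumpsAfter I a e m z ⊆ jumpsAfter I a e m y := by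
  intro i hi
  simp only [jumpsAfter, Finset.mem_filter] at hi ⊢
  exact ⟨hi.1, hi.2.1, hyz.trans_lt hi.2.2⟩

theorem card_jumpsAfter_lt (hyz : y ≤ z)
    (h : ¬ ∀ i ∈ I, e i = m → y < a i → z < a i) :
    (jumpsAfter I a e m z).card < (jumpsAfter I a e m y).card := by
  push Not at h
  obtain ⟨i, hi, hm, hy, hz⟩ := h
  refine Finset.card_lt_card ⟨jumpsAfter_subset hyz, fun hsub => ?_⟩
  have := hsub (show i ∈ jumpsAfter I a e m y by simp [jumpsAfter, hi, hm, hy])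
  simp only [jumpsAfter, Finset.mem_filter] at this
  linarith [this.2.2]

/-- Each jump destroys at most two of the sign alternations that oscillation forces on the
derivative. -/
theorem OscillatesFrom.alternatesFrom_truncSum_succ
    (h : OscillatesFrom (truncSum I a e c m) n σ y) :
    AlternatesFrom (truncSum I a e c (m + 1)) (n - 2 * (jumpsAfter I a e m y).card) σ y := by
  induction n using Nat.strong_induction_on generalizing σ y with
  | _ n ih =>
    cases n with
    | zero => simp [AlternatesFrom]
    | succ n =>
      obtain ⟨z, hyz, hpos, h⟩ := h
      by_cases hj : ∀ i ∈ I, e i = m → y < a i → z < a i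
      · obtain ⟨x, hyx, hxz, hx⟩ := exists_pos_truncSum_succ hyz hpos hj
        have hle := Finset.card_le_card (jumpsAfter_subset (I := I) (a := a) (e := e) (m := m) hyz)
        have hrest := (ih n (by omega) h).of_le hxz
        exact AlternatesFrom.anti
          (n := n - 2 * (jumpsAfter I a e m z).card + 1) (by omega) ⟨x, hyx, hx, hrest⟩
      · have hlt := card_jumpsAfter_lt hyz hj
        cases n with
        | zero =>
          rw [show 0 + 1 - 2 * (jumpsAfter I a e m y).card = 0 by omega]
          trivial
        | succ n =>
          obtain ⟨w, hzw, -, h⟩ := h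
          have hle := Finset.card_le_card
            (jumpsAfter_subset (I := I) (a := a) (e := e) (m := m) hzw)
          rw [neg_neg] at h
          exact ((ih n (by omega) h).of_le (hyz.trans hzw)).anti (by omega)

theorem truncSum_eq_zero_of_lt (hm : ∀ i ∈ I, e i < m) (x : ℝ) : truncSum I a e c m x = 0 :=
  Finset.sum_eq_zero fun i hi => by simp [Nat.descFactorial_of_lt (hm i hi)]

theorem OscillatesFrom.le_card_jumpsAfter (hm : ∀ i ∈ I, e i ≤ m)
    (h : OscillatesFrom (truncSum I a e c m) n σ y) : n ≤ (jumpsAfter I a e m y).card := by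
  induction n generalizing σ y with
  | zero => simp
  | succ n ih =>
    obtain ⟨z, hyz, hpos, h⟩ := h
    have hlt := card_jumpsAfter_lt (I := I) (a := a) (e := e) (m := m) hyz fun hj => by
      obtain ⟨x, -, -, hx⟩ := exists_pos_truncSum_succ hyz hpos hj
      rw [truncSum_eq_zero_of_lt fun i hi => Nat.lt_succ_of_le (hm i hi)] at hx
      simp at hx
    have := ih h
    omega

theorem truncSum_eq_zero_of_forall_lt (h : ∀ i ∈ I, t < a i) : truncSum I a e c m t = 0 :=
  Finset.sum_eq_zero fun i hi => if_neg (not_le.mpr (h i hi))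

theorem truncSum_eq_zero_of_forall_le (hsum : ∑ i ∈ I, C (c i) * (X - C (a i)) ^ e i = 0)
    (h : ∀ i ∈ I, a i ≤ t) : truncSum I a e c m t = 0 := by
  have h0 := congrArg (fun p => (derivative^[m] p).eval t) hsum
  simp only [iterate_derivative_sum, iterate_derivative_C_mul, iterate_derivative_X_sub_pow,
    eval_finsetSum, iterate_derivative_zero, eval_zero] at h0
  rw [← h0]
  refine Finset.sum_congr rfl fun i hi => ?_
  simp [h i hi, mul_assoc]

theorem exists_truncSum_eq_zero (hsum : ∑ i ∈ I, C (c i) * (X - C (a i)) ^ e i = 0) (t : ℝ) :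
    ∃ x, t ≤ x ∧ truncSum I a e c m x = 0 := by
  obtain ⟨M, hM⟩ := (I.image a).bddAbove
  refine ⟨max t M, le_max_left _ _, truncSum_eq_zero_of_forall_le hsum fun i hi => ?_⟩
  exact (hM (Finset.mem_coe.mpr (Finset.mem_image_of_mem a hi))).trans (le_max_right _ _)

theorem exists_truncSum_ne_zero (hdist : Set.InjOn (fun i => (a i, e i)) I)
    (hc : ∀ i ∈ I, c i ≠ 0) {d : ℕ} (hd : ∀ i ∈ I, e i ≤ d) (hex : ∃ i ∈ I, e i = d)
    (hmd : m ≤ d) : ∃ x, truncSum I a e c m x ≠ 0 := by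
  induction hmd using Nat.decreasingInduction with
  | self =>
    obtain ⟨i, hi, hmin⟩ := Finset.exists_min_image {i ∈ I | e i = d} a
      (by obtain ⟨i, hi, hid⟩ := hex; exact ⟨i, by simp [hi, hid]⟩)
    rw [Finset.mem_filter] at hi
    refine ⟨a i, ?_⟩
    unfold truncSum
    rw [Finset.sum_eq_single_of_mem i hi.1]
    · simp [hi.2, hc i hi.1, Nat.descFactorial_self, Nat.factorial_ne_zero]
    · intro j hj hji
      rcases (hd j hj).lt_or_eq with hlt | heq
      · simp [Nat.descFactorial_of_lt hlt]
      · refine if_neg fun hle => hji (hdist hj hi.1 ?_)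
        have := hmin j (by simp [hj, heq])
        simp [le_antisymm hle this, heq, hi.2]
  | of_succ k _ ih =>
    by_contra! hzero
    obtain ⟨x, hx⟩ := ih
    have h1 := hasDerivWithinAt_truncSum (I := I) (a := a) (e := e) (c := c) k x
    rw [show truncSum I a e c k = fun _ => 0 from funext hzero] at h1
    exact hx ((uniqueDiffOn_Ici x x Set.self_mem_Ici).eq_deriv _ h1
      (hasDerivWithinAt_const x _ 0))

theorem exists_alternatesFrom_truncSum (hdist : Set.InjOn (fun i => (a i, e i)) I)
    (hc : ∀ i ∈ I, c i ≠ 0) (hsum : ∑ i ∈ I, C (c i) * (X - C (a i)) ^ e i = 0)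
    {d : ℕ} (hd : ∀ i ∈ I, e i ≤ d) (hex : ∃ i ∈ I, e i = d) (ht : ∀ i ∈ I, t < a i)
    (hmd : m ≤ d) :
    ∃ n σ, 1 ≤ n ∧ m + 1 ≤ n + 2 * {i ∈ I | e i < m}.card ∧
      AlternatesFrom (truncSum I a e c m) n σ t := by
  have hone : ∀ m ≤ d, ∃ σ, AlternatesFrom (truncSum I a e c m) 1 σ t := fun m hmd => by
    obtain ⟨x, hx⟩ := exists_truncSum_ne_zero hdist hc hd hex hmd
    refine ⟨truncSum I a e c m x, x, ?_, mul_self_pos.mpr hx, trivial⟩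
    by_contra! hxt
    exact hx (truncSum_eq_zero_of_forall_lt fun i hi => hxt.trans (ht i hi))
  induction m with
  | zero =>
    obtain ⟨σ, hσ⟩ := hone 0 hmd
    exact ⟨1, σ, le_rfl, by omega, hσ⟩
  | succ m ih =>
    obtain ⟨n, σ, hn, hcard, h⟩ := ih (by omega)
    obtain ⟨n, rfl⟩ : ∃ k, n = k + 1 := ⟨n - 1, by omega⟩
    have halt := (h.oscillatesFrom_of_eq_zero (exists_truncSum_eq_zero hsum)
      (truncSum_eq_zero_of_forall_lt ht)).alternatesFrom_truncSum_succ
    have hsplit : {i ∈ I | e i < m}.card + (jumpsAfter I a e m t).card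
        ≤ {i ∈ I | e i < m + 1}.card := by
      classical
      rw [← Finset.card_union_of_disjoint]
      · refine Finset.card_le_card fun i hi => ?_
        simp only [jumpsAfter, Finset.mem_union, Finset.mem_filter] at hi ⊢
        grind
      · rw [Finset.disjoint_left]
        intro i hi hi'
        simp only [jumpsAfter, Finset.mem_filter] at hi hi'
        omega
    by_cases hpos : 1 ≤ n + 2 - 2 * (jumpsAfter I a e m t).card
    · exact ⟨_, σ, hpos, by omega, halt⟩
    · obtain ⟨τ, hτ⟩ := hone (m + 1) hmd
      exact ⟨1, τ, le_rfl, by omega, hτ⟩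

/-- A linear relation with nonzero coefficients between distinct real shifted powers bounds their
maximal exponent. -/
theorem exponent_bound_of_sum_eq_zero (hdist : Set.InjOn (fun i => (a i, e i)) I)
    (hc : ∀ i ∈ I, c i ≠ 0) (hsum : ∑ i ∈ I, C (c i) * (X - C (a i)) ^ e i = 0)
    {d : ℕ} (hd : ∀ i ∈ I, e i ≤ d) (hex : ∃ i ∈ I, e i = d) :
    2 ≤ {i ∈ I | e i = d}.card ∧ d + 2 + {i ∈ I | e i = d}.card ≤ 2 * I.card := by
  obtain ⟨t, ht⟩ : ∃ t, ∀ i ∈ I, t < a i := by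
    obtain ⟨M, hM⟩ := (I.image a).bddBelow
    refine ⟨M - 1, fun i hi => ?_⟩
    linarith [hM (Finset.mem_coe.mpr (Finset.mem_image_of_mem a hi))]
  obtain ⟨n, σ, hn, hcard, h⟩ :=
    exists_alternatesFrom_truncSum hdist hc hsum hd hex ht le_rfl
  obtain ⟨n, rfl⟩ : ∃ k, n = k + 1 := ⟨n - 1, by omega⟩
  have hle := (h.oscillatesFrom_of_eq_zero (exists_truncSum_eq_zero hsum)
    (truncSum_eq_zero_of_forall_lt ht)).le_card_jumpsAfter hd
  have hjump : (jumpsAfter I a e d t).card ≤ {i ∈ I | e i = d}.card :=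
    Finset.card_le_card fun i hi => by
      simp only [jumpsAfter, Finset.mem_filter] at hi ⊢
      exact ⟨hi.1, hi.2.1⟩
  have hlt : {i ∈ I | e i < d} = {i ∈ I | ¬ e i = d} :=
    Finset.filter_congr fun i hi => by have := hd i hi; omega
  have htotal := Finset.card_filter_add_card_filter_not (s := I) (fun i => e i = d)
  rw [hlt] at hcard
  omega

end TruncatedPowers

theorem stmt7 (s : ℕ) (a : Fin s → ℝ) (e : Fin s → ℕ)
    (hdist : Function.Injective (fun i => (a i, e i)))
    (hbig : ∀ i, max 1 (2 * s - 4) ≤ e i) :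
    LinearIndependent ℝ (fun i : Fin s => (X - C (a i)) ^ (e i)) := by
  rw [Fintype.linearIndependent_iff]
  intro c hsum
  by_contra! hne
  obtain ⟨i₀, hi₀⟩ := hne
  have hsum' : ∑ i with c i ≠ 0, C (c i) * (X - C (a i)) ^ e i = 0 := by
    rw [← hsum, Finset.sum_filter]
    refine Finset.sum_congr rfl fun i _ => ?_
    by_cases hi : c i = 0 <;> simp [hi, smul_eq_C_mul]
  obtain ⟨j, hj, hmax⟩ := Finset.exists_max_image {i | c i ≠ 0} e ⟨i₀, by simp [hi₀]⟩
  obtain ⟨htwo, hbound⟩ := exponent_bound_of_sum_eq_zero hdist.injOn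
    (fun i hi => (Finset.mem_filter.mp hi).2) hsum' hmax ⟨j, hj, rfl⟩
  have hcard : Finset.card {i | c i ≠ 0} ≤ s := (Finset.card_le_univ _).trans_eq (by simp)
  have hj' := hbig j
  have hall : Finset.filter (fun i => e i = e j) {i | c i ≠ 0} =
      (Finset.univ.filter fun i => c i ≠ 0) :=
    Finset.filter_true_of_mem fun i hi => by
      have := hmax i hi
      have := hbig i
      omega
  rw [hall] at htwo hbound
  omega
end

section
/- Let F = {(x - a_i)^{e_i} : 1 ≤ i ≤ s} be a family of pairwise distinct shifted powers with a_i ∈ ℝ whose exponent sequence satisfies the Pólya condition. Then the dimension of the ℝ-linear span of F is at least ⌊s/2⌋ + 1. -/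
open Polynomial

/-- A real polynomial all of whose roots in an open interval have even multiplicity does not
change sign on that interval. -/
theorem Polynomial.eval_mul_eval_nonneg_of_even_rootMultiplicity (p : ℝ[X]) (x y : ℝ)
    (hp : ∀ z ∈ Set.Ioo x y, Even (p.rootMultiplicity z)) :
    ∀ u ∈ Set.Ioo x y, ∀ v ∈ Set.Ioo x y, 0 ≤ p.eval u * p.eval v := by
  induction h : p.natDegree using Nat.strong_induction_on generalizing p with
  | _ n ih =>
  subst h
  by_cases hr : ∃ z ∈ Set.Ioo x y, p.IsRoot z
  · obtain ⟨z, hz, hpz⟩ := hr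
    rcases eq_or_ne p 0 with rfl | hp0
    · simp
    obtain ⟨q, hq, hdvd⟩ := p.exists_eq_pow_rootMultiplicity_mul_and_not_dvd hp0 z
    set m := p.rootMultiplicity z with hm
    have hq0 : q ≠ 0 := by rintro rfl; simp at hdvd
    have hmpos : 0 < m := (rootMultiplicity_pos hp0).2 hpz
    have hpq : (X - C z) ^ m * q ≠ 0 := hq ▸ hp0
    have hqeven : ∀ w ∈ Set.Ioo x y, Even (q.rootMultiplicity w) := by
      intro w hw
      rcases eq_or_ne w z with rfl | hwz
      · rw [rootMultiplicity_eq_zero]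
        · simp
        · rwa [← dvd_iff_isRoot]
      · have h1 := hp w hw
        rw [hq, rootMultiplicity_mul hpq, rootMultiplicity_eq_zero (p := (X - C z) ^ m)] at h1
        · simpa using h1
        · simp [IsRoot, sub_eq_zero, hwz]
    have hdeg : q.natDegree < p.natDegree := by
      rw [hq, natDegree_mul (pow_ne_zero _ (X_sub_C_ne_zero z)) hq0, natDegree_pow,
        natDegree_X_sub_C]
      omega
    intro u hu v hv
    have h1 := ih _ hdeg q hqeven rfl u hu v hv
    have hme : Even m := hp z hz
    rw [hq]
    simp only [eval_mul, eval_pow, eval_sub, eval_X, eval_C]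
    calc 0 ≤ ((u - z) ^ m * (v - z) ^ m) * (q.eval u * q.eval v) :=
          mul_nonneg (mul_nonneg (hme.pow_nonneg _) (hme.pow_nonneg _)) h1
      _ = _ := by ring
  · push Not at hr
    intro u hu v hv
    by_contra! hlt
    have key : ∀ u ∈ Set.Ioo x y, ∀ v ∈ Set.Ioo x y, p.eval u < 0 → 0 < p.eval v → False := by
      intro u hu v hv h1 h2
      obtain ⟨z, hz, hz0⟩ := isPreconnected_Ioo.intermediate_value hu hv
        (f := fun t => p.eval t) p.continuousOn ⟨h1.le, h2.le⟩
      exact hr z hz hz0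
    rcases mul_neg_iff.1 hlt with ⟨h1, h2⟩ | ⟨h1, h2⟩
    · exact key v hv u hu h2 h1
    · exact key u hu v hv h1 h2

/-- Rolle's theorem with parity: between two roots of a real polynomial its derivative has a root
of odd multiplicity. -/
theorem Polynomial.exists_odd_rootMultiplicity_derivative {p : ℝ[X]} (hp : p ≠ 0) {x y : ℝ}
    (hxy : x < y) (hx : p.IsRoot x) (hy : p.IsRoot y) :
    ∃ z, x < z ∧ z < y ∧ Odd (p.derivative.rootMultiplicity z) := by
  by_contra! hcon
  have heven : ∀ z ∈ Set.Ioo x y, Even (p.derivative.rootMultiplicity z) := fun z hz =>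
    Nat.not_odd_iff_even.1 (hcon z hz.1 hz.2)
  have hsign := p.derivative.eval_mul_eval_nonneg_of_even_rootMultiplicity x y heven
  have hmono : ∀ q : ℝ[X], q ≠ 0 → q.IsRoot x → q.IsRoot y →
      ¬ ∀ z ∈ Set.Ioo x y, 0 ≤ q.derivative.eval z := by
    intro q hq hqx hqy hnn
    have hm : MonotoneOn (fun t => q.eval t) (Set.Icc x y) := by
      apply monotoneOn_of_deriv_nonneg (convex_Icc x y) q.continuousOn
        q.differentiable.differentiableOn
      intro t ht
      rw [interior_Icc] at ht
      simpa using hnn t ht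
    have hzero : ∀ t ∈ Set.Icc x y, q.IsRoot t := by
      intro t ht
      have h1 := hm (Set.left_mem_Icc.2 hxy.le) ht ht.1
      have h2 := hm ht (Set.right_mem_Icc.2 hxy.le) ht.2
      simp only [IsRoot.def] at hqx hqy ⊢
      simp only [hqx, hqy] at h1 h2
      exact le_antisymm h2 h1
    exact hq (eq_zero_of_infinite_isRoot q ((Set.Icc_infinite hxy).mono hzero))
  have h1 := hmono p hp hx hy
  have h2 := hmono (-p) (neg_ne_zero.2 hp) (by simpa using hx) (by simpa using hy)
  push Not at h1 h2
  obtain ⟨u, hu, hu'⟩ := h1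
  obtain ⟨v, hv, hv'⟩ := h2
  simp only [derivative_neg, eval_neg] at hv'
  have := hsign u hu v hv
  nlinarith

/-- A refinement of `Polynomial.card_roots_le_derivative` taking multiplicities of the new roots
of the derivative into account. -/
theorem Polynomial.card_roots_add_sum_le_card_roots_derivative {p : ℝ[X]} (hp : p ≠ 0) :
    Multiset.card p.roots + ∑ a ∈ p.derivative.roots.toFinset \ p.roots.toFinset,
      2 * (p.derivative.rootMultiplicity a / 2) ≤ Multiset.card p.derivative.roots + 1 := by
  set D := p.derivative.roots.toFinset \ p.roots.toFinset with hD
  set O := p.derivative.roots.toFinset.filter (fun a => Odd (p.derivative.rootMultiplicity a))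
  have hroll : p.roots.toFinset.card ≤ (O \ p.roots.toFinset).card + 1 := by
    refine Finset.card_le_sdiff_of_interleaved fun x hx y hy hxy _ => ?_
    rw [Multiset.mem_toFinset, mem_roots hp] at hx hy
    obtain ⟨z, hz1, hz2, hz⟩ := exists_odd_rootMultiplicity_derivative hp hxy hx hy
    refine ⟨z, ?_, hz1, hz2⟩
    rw [Finset.mem_filter, Multiset.mem_toFinset, ← Multiset.count_pos, count_roots]
    exact ⟨hz.pos, hz⟩
  have hO : (O \ p.roots.toFinset).card =
      ∑ a ∈ D, p.derivative.rootMultiplicity a % 2 := by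
    have : O \ p.roots.toFinset = D.filter (fun a => Odd (p.derivative.rootMultiplicity a)) := by
      ext a; simp only [O, hD, Finset.mem_sdiff, Finset.mem_filter]; tauto
    rw [this, Finset.card_filter]
    refine Finset.sum_congr rfl fun a _ => ?_
    split_ifs with h
    · rw [Nat.odd_iff.1 h]
    · rw [Nat.even_iff.1 (Nat.not_odd_iff_even.1 h)]
  have hR : Multiset.card p.roots =
      ∑ a ∈ p.roots.toFinset, p.derivative.rootMultiplicity a + p.roots.toFinset.card := by
    rw [← Multiset.toFinset_sum_count_eq, Finset.card_eq_sum_ones, ← Finset.sum_add_distrib]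
    refine Finset.sum_congr rfl fun a ha => ?_
    have hc := Multiset.count_pos.2 (Multiset.mem_toFinset.1 ha)
    rw [Multiset.mem_toFinset, mem_roots hp] at ha
    rw [count_roots] at hc ⊢
    rw [derivative_rootMultiplicity_of_root ha]
    omega
  have hR' : Multiset.card p.derivative.roots =
      ∑ a ∈ p.roots.toFinset, p.derivative.rootMultiplicity a +
        ∑ a ∈ D, p.derivative.rootMultiplicity a := by
    rw [← Finset.sum_union Finset.disjoint_sdiff, Finset.union_sdiff_self_eq_union,
      ← Multiset.toFinset_sum_count_eq, ← Finset.sum_subset Finset.subset_union_right]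
    · simp only [count_roots]
    · intro x _ hx
      rwa [Multiset.mem_toFinset, ← Multiset.count_eq_zero, count_roots] at hx
  have hsplit : ∑ a ∈ D, p.derivative.rootMultiplicity a =
      ∑ a ∈ D, 2 * (p.derivative.rootMultiplicity a / 2) +
        ∑ a ∈ D, p.derivative.rootMultiplicity a % 2 := by
    rw [← Finset.sum_add_distrib]
    exact Finset.sum_congr rfl fun a _ => (Nat.div_add_mod _ 2).symm
  omega

/-- A set of Birkhoff interpolation conditions `(a, k)`, standing for the vanishing of the `k`-th
derivative at `a`, has even gaps if every maximal run of consecutive orders at a node which does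
not start at order `0` has even length. -/
def EvenGaps (E : Finset (ℝ × ℕ)) : Prop :=
  ∀ a i j, (a, i) ∉ E → (a, j) ∉ E → Even ((Finset.Ioo i j).filter (fun k => (a, k) ∈ E)).card

/-- The conditions imposed on the derivative of a polynomial by the conditions `E`. -/
noncomputable def derivConditions (E : Finset (ℝ × ℕ)) : Finset (ℝ × ℕ) :=
  (E.filter (fun x => 0 < x.2)).image (fun x => (x.1, x.2 - 1))

theorem mem_derivConditions {E : Finset (ℝ × ℕ)} {a : ℝ} {k : ℕ} :
    (a, k) ∈ derivConditions E ↔ (a, k + 1) ∈ E := by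
  simp only [derivConditions, Finset.mem_image, Finset.mem_filter, Prod.exists, Prod.mk.injEq]
  constructor
  · rintro ⟨b, l, ⟨h, hl⟩, rfl, rfl⟩
    rwa [Nat.sub_add_cancel hl]
  · intro h
    exact ⟨a, k + 1, ⟨h, k.succ_pos⟩, rfl, rfl⟩

theorem EvenGaps.derivConditions {E : Finset (ℝ × ℕ)} (hE : EvenGaps E) :
    EvenGaps (derivConditions E) := by
  intro a i j hi hj
  rw [mem_derivConditions] at hi hj
  have h := hE a (i + 1) (j + 1) hi hj
  have himg : (Finset.Ioo (i + 1) (j + 1)).filter (fun k => (a, k) ∈ E) =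
      ((Finset.Ioo i j).filter (fun k => (a, k) ∈ _root_.derivConditions E)).image (· + 1) := by
    ext k
    simp only [Finset.mem_filter, Finset.mem_Ioo, Finset.mem_image, mem_derivConditions]
    constructor
    · rintro ⟨⟨h1, h2⟩, h3⟩
      obtain ⟨l, rfl⟩ : ∃ l, k = l + 1 := ⟨k - 1, by omega⟩
      exact ⟨l, ⟨⟨by omega, by omega⟩, h3⟩, rfl⟩
    · rintro ⟨l, ⟨⟨h1, h2⟩, h3⟩, rfl⟩
      exact ⟨⟨by omega, by omega⟩, h3⟩
  rwa [himg, Finset.card_image_of_injective _ (add_left_injective 1)] at h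

/-- The roots of a polynomial, together with the conditions it satisfies beyond its roots, number
at most its degree. -/
theorem Polynomial.card_roots_add_card_conditions_le_natDegree {p : ℝ[X]} (hp : p ≠ 0)
    {E : Finset (ℝ × ℕ)} (hE : EvenGaps E) (hroot : ∀ x ∈ E, (derivative^[x.2] p).IsRoot x.1) :
    Multiset.card p.roots + (E.filter (fun x =>
      p.rootMultiplicity x.1 < x.2 ∧ x.2 ≤ p.natDegree)).card ≤ p.natDegree := by
  induction h : p.natDegree generalizing p E with
  | zero =>
    have h1 := p.card_roots'
    have h2 : E.filter (fun x => p.rootMultiplicity x.1 < x.2 ∧ x.2 ≤ 0) = ∅ := by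
      ext x
      simp only [Finset.mem_filter, Finset.notMem_empty, iff_false]
      omega
    rw [h2, Finset.card_empty]
    omega
  | succ n ih =>
    have hdeg : p.derivative.natDegree = n := by rw [natDegree_derivative]; omega
    have hp' : p.derivative ≠ 0 := fun h0 => by
      have := derivative_eq_zero.1 h0
      omega
    have hroot' : ∀ x ∈ derivConditions E, (derivative^[x.2] p.derivative).IsRoot x.1 := by
      rintro ⟨a, k⟩ hx
      exact hroot _ (mem_derivConditions.1 hx)
    have hih := ih hp' hE.derivConditions hroot' hdeg
    have hrolle := card_roots_add_sum_le_card_roots_derivative hp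
    set D := p.derivative.roots.toFinset \ p.roots.toFinset
    set B := (derivConditions E).filter (fun x => p.derivative.rootMultiplicity x.1 < x.2 ∧ x.2 ≤ n)
    let G : ℝ → Finset ℕ := fun a =>
      (Finset.Ioo 0 (p.derivative.rootMultiplicity a + 1)).filter (fun k => (a, k) ∈ E)
    have hne : ∀ a, (a, p.derivative.rootMultiplicity a + 1) ∉ E := by
      intro a ha
      refine lt_irrefl (p.derivative.rootMultiplicity a)
        ((lt_rootMultiplicity_iff_isRoot_iterate_derivative hp').2 fun m hm => ?_)
      rcases hm.lt_or_eq with hlt | rfl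
      · exact isRoot_iterate_derivative_of_lt_rootMultiplicity hlt
      · exact hroot _ ha
    have hsub : E.filter (fun x => p.rootMultiplicity x.1 < x.2 ∧ x.2 ≤ n + 1) ⊆
        B.image (fun x => (x.1, x.2 + 1)) ∪ D.biUnion (fun a => (G a).image (Prod.mk a)) := by
      rintro ⟨a, k⟩ hx
      simp only [Finset.mem_filter] at hx
      obtain ⟨hx, h1, h2⟩ := hx
      obtain ⟨l, rfl⟩ : ∃ l, k = l + 1 := ⟨k - 1, by omega⟩
      rw [Finset.mem_union]
      rcases lt_trichotomy l (p.derivative.rootMultiplicity a) with hl | hl | hl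
      · right
        have hnr : ¬ p.IsRoot a := by
          intro hr
          have := derivative_rootMultiplicity_of_root hr
          omega
        simp only [Finset.mem_biUnion, Finset.mem_image, D, G, Finset.mem_sdiff,
          Multiset.mem_toFinset, mem_roots hp, mem_roots hp', Finset.mem_filter, Finset.mem_Ioo]
        exact ⟨a, ⟨(rootMultiplicity_pos hp').1 (by omega), hnr⟩, l + 1,
          ⟨⟨by omega, by omega⟩, hx⟩, rfl⟩
      · exact absurd (hl ▸ hx) (hne a)
      · left
        rw [Finset.mem_image]
        refine ⟨(a, l), ?_, rfl⟩
        simp only [B, Finset.mem_filter, mem_derivConditions]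
        exact ⟨hx, hl, by omega⟩
    have hG : ∀ a ∈ D, (G a).card ≤ 2 * (p.derivative.rootMultiplicity a / 2) := by
      intro a ha
      have hnr : (a, 0) ∉ E := by
        intro h0
        simp only [D, Finset.mem_sdiff, Multiset.mem_toFinset, mem_roots hp] at ha
        exact ha.2 (hroot _ h0)
      have heven : Even (G a).card := hE a _ _ hnr (hne a)
      have hle : (G a).card ≤ p.derivative.rootMultiplicity a := by
        refine (Finset.card_filter_le _ _).trans ?_
        rw [Nat.card_Ioo]
        omega
      obtain ⟨r, hr⟩ := heven
      omega
    have hcard := (Finset.card_le_card hsub).trans (Finset.card_union_le _ _)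
    have h1 : (B.image (fun x => (x.1, x.2 + 1))).card ≤ B.card := Finset.card_image_le
    have h2 : (D.biUnion (fun a => (G a).image (Prod.mk a))).card ≤
        ∑ a ∈ D, 2 * (p.derivative.rootMultiplicity a / 2) :=
      Finset.card_biUnion_le.trans
        (Finset.sum_le_sum fun a ha => Finset.card_image_le.trans (hG a ha))
    omega

/-- A nonzero real polynomial of degree `n` satisfies at most `n` conditions of order at most `n`
from a set of conditions with even gaps. -/
theorem Polynomial.card_conditions_le_natDegree {p : ℝ[X]} (hp : p ≠ 0)
    {E : Finset (ℝ × ℕ)} (hE : EvenGaps E) (hroot : ∀ x ∈ E, (derivative^[x.2] p).IsRoot x.1) :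
    (E.filter (fun x => x.2 ≤ p.natDegree)).card ≤ p.natDegree := by
  have h := card_roots_add_card_conditions_le_natDegree hp hE hroot
  have hsub : E.filter (fun x => x.2 ≤ p.natDegree) ⊆
      p.roots.toFinset.biUnion (fun a => (Finset.range (p.rootMultiplicity a)).image (Prod.mk a)) ∪
      E.filter (fun x => p.rootMultiplicity x.1 < x.2 ∧ x.2 ≤ p.natDegree) := by
    rintro ⟨a, k⟩ hx
    simp only [Finset.mem_filter] at hx
    simp only [Finset.mem_union, Finset.mem_biUnion, Finset.mem_image, Finset.mem_filter,
      Multiset.mem_toFinset, mem_roots hp, Finset.mem_range]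
    rcases lt_trichotomy k (p.rootMultiplicity a) with hk | hk | hk
    · exact Or.inl ⟨a, (rootMultiplicity_pos hp).1 (by omega), k, hk, rfl⟩
    · exfalso
      refine lt_irrefl (p.rootMultiplicity a)
        ((lt_rootMultiplicity_iff_isRoot_iterate_derivative hp).2 fun m hm => ?_)
      rcases hm.lt_or_eq with hlt | rfl
      · exact isRoot_iterate_derivative_of_lt_rootMultiplicity hlt
      · exact hk ▸ hroot _ hx.1
    · exact Or.inr ⟨hx.1, hk, hx.2⟩
  have hcard := (Finset.card_le_card hsub).trans (Finset.card_union_le _ _)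
  have h2 : (p.roots.toFinset.biUnion
      (fun a => (Finset.range (p.rootMultiplicity a)).image (Prod.mk a))).card ≤
      Multiset.card p.roots := by
    refine Finset.card_biUnion_le.trans ?_
    rw [← Multiset.toFinset_sum_count_eq]
    refine Finset.sum_le_sum fun a _ => Finset.card_image_le.trans ?_
    rw [Finset.card_range, count_roots]
  omega

/-- Every set `P` of conditions extends to one with even gaps by adding conditions of order one
less than conditions of `P`. -/
theorem exists_evenGaps_superset (P : Finset (ℝ × ℕ)) :
    ∃ E : Finset (ℝ × ℕ), P ⊆ E ∧ EvenGaps E ∧ ∀ a k, (a, k) ∈ E → (a, k) ∈ P ∨ (a, k + 1) ∈ P := by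
  induction P using Finset.induction_on_min_value (fun x : ℝ × ℕ => x.2) with
  | empty => exact ⟨∅, by simp, by intro a i j _ _; simp, by simp⟩
  | insert t P ht hmin ih =>
    obtain ⟨E, hPE, hE, hEP⟩ := ih
    by_cases htE : t ∈ E
    · refine ⟨E, Finset.insert_subset htE hPE, hE, fun a k hak => ?_⟩
      rcases hEP a k hak with h | h <;> simp [h]
    obtain ⟨a, k⟩ := t
    rcases k with _ | k
    · refine ⟨insert (a, 0) E, Finset.insert_subset_insert _ hPE, ?_, ?_⟩
      · intro b i j hi hj
        simp only [Finset.mem_insert, not_or] at hi hj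
        convert hE b i j hi.2 hj.2 using 2
        refine Finset.filter_congr fun l hl => ?_
        rw [Finset.mem_Ioo] at hl
        simp only [Finset.mem_insert, Prod.mk.injEq, or_iff_right_iff_imp]
        omega
      · intro b l hbl
        rw [Finset.mem_insert] at hbl
        rcases hbl with h | h
        · simp [h]
        · rcases hEP b l h with h | h <;> simp [h]
    · have hkE : (a, k) ∉ E := by
        intro hk
        rcases hEP a k hk with h | h
        · have := hmin _ h
          simp at this
        · exact ht h
      refine ⟨insert (a, k) (insert (a, k + 1) E), ?_, ?_, ?_⟩
      · exact (Finset.insert_subset_insert _ hPE).trans (Finset.subset_insert _ _)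
      · intro b i j hi hj
        simp only [Finset.mem_insert, not_or, Prod.mk.injEq, not_and] at hi hj
        have h := hE b i j hi.2.2 hj.2.2
        by_cases hin : b = a ∧ i < k ∧ k + 1 < j
        · obtain ⟨rfl, h1, h2⟩ := hin
          have heq : (Finset.Ioo i j).filter (fun l => (b, l) ∈ insert (b, k) (insert (b, k + 1) E)) =
              insert k (insert (k + 1) ((Finset.Ioo i j).filter (fun l => (b, l) ∈ E))) := by
            ext l
            simp only [Finset.mem_insert, Finset.mem_filter, Finset.mem_Ioo, Prod.mk.injEq,
              true_and]
            constructor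
            · tauto
            · rintro (rfl | rfl | h)
              · exact ⟨⟨by omega, by omega⟩, by simp⟩
              · exact ⟨⟨by omega, by omega⟩, by simp⟩
              · tauto
          rw [heq, Finset.card_insert_of_notMem, Finset.card_insert_of_notMem, add_assoc]
          · exact h.add (by decide)
          · simp [htE]
          · simp [hkE]
        · convert h using 2
          refine Finset.filter_congr fun l hl => ?_
          rw [Finset.mem_Ioo] at hl
          simp only [Finset.mem_insert, Prod.mk.injEq]
          constructor
          · rintro (⟨rfl, rfl⟩ | ⟨rfl, rfl⟩ | h)
            · have := hj.2.1 rfl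
              exact absurd ⟨rfl, hl.1, by omega⟩ hin
            · have := hi.1 rfl
              exact absurd ⟨rfl, by omega, by omega⟩ hin
            · exact h
          · tauto
      · intro b l hbl
        simp only [Finset.mem_insert, Prod.mk.injEq] at hbl ⊢
        rcases hbl with ⟨rfl, rfl⟩ | ⟨rfl, rfl⟩ | h
        · simp
        · simp
        · rcases hEP b l h with h | h <;> simp [h]

/-- A set of conditions with even gaps can be enlarged by conditions of order `0` to any larger
size. -/
theorem EvenGaps.exists_superset_card_eq {E : Finset (ℝ × ℕ)} (hE : EvenGaps E) (n : ℕ)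
    (hn : E.card ≤ n) :
    ∃ E' : Finset (ℝ × ℕ), E ⊆ E' ∧ EvenGaps E' ∧ E'.card = n ∧
      ∀ x ∈ E', x ∈ E ∨ x.2 = 0 := by
  have hinf : ((Set.range fun b : ℝ => (b, 0)) \ (E : Set (ℝ × ℕ))).Infinite :=
    (Set.infinite_range_of_injective fun x y h => (Prod.mk.inj h).1).sdiff E.finite_toSet
  obtain ⟨F, hF, hFcard⟩ := hinf.exists_subset_card_eq (n - E.card)
  have hF0 : ∀ x ∈ F, x.2 = 0 := by
    intro x hx
    obtain ⟨b, rfl⟩ := (hF hx).1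
    rfl
  refine ⟨E ∪ F, Finset.subset_union_left, ?_, ?_, ?_⟩
  · intro a i j hi hj
    simp only [Finset.mem_union, not_or] at hi hj
    convert hE a i j hi.1 hj.1 using 2
    refine Finset.filter_congr fun l hl => ?_
    rw [Finset.mem_Ioo] at hl
    simp only [Finset.mem_union, or_iff_left_iff_imp]
    intro h
    have := hF0 _ h
    simp only at this
    omega
  · rw [Finset.card_union_of_disjoint, hFcard, Nat.add_sub_cancel' hn]
    rw [Finset.disjoint_right]
    exact fun x hx => (hF hx).2
  · intro x hx
    exact (Finset.mem_union.1 hx).imp_right (hF0 x)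

/-- Unisolvence of Birkhoff interpolation for conditions with even gaps satisfying the Pólya
condition (Atkinson and Sharma). -/
theorem EvenGaps.eq_zero_of_isRoot {E : Finset (ℝ × ℕ)} (hE : EvenGaps E) {d : ℕ}
    (hcard : E.card = d + 1)
    (hpolya : ∀ m, 0 < m → m ≤ d + 1 → (E.filter (fun x => m ≤ x.2)).card + m ≤ d + 1)
    {p : ℝ[X]} (hdeg : p.natDegree ≤ d) (hroot : ∀ x ∈ E, (derivative^[x.2] p).IsRoot x.1) :
    p = 0 := by
  by_contra hp
  have h1 := card_conditions_le_natDegree hp hE hroot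
  have h2 := hpolya (p.natDegree + 1) (by omega) (by omega)
  have h3 := E.card_filter_add_card_filter_not (fun x => x.2 ≤ p.natDegree)
  simp only [not_le, ← Nat.succ_le_iff, Nat.succ_eq_add_one] at h3
  omega

/-- The pairing on polynomials of degree at most `d` for which a shifted power of exponent `e`
represents the `(d - e)`-th derivative at its node, up to a scalar. -/
theorem Polynomial.sum_coeff_mul_coeff_X_sub_C_pow {d e : ℕ} (he : e ≤ d) (a : ℝ) {f : ℝ[X]}
    (hf : f.natDegree ≤ d) :
    ∑ j ∈ Finset.range (d + 1), f.coeff j * (j.factorial * (d - j).factorial * (-1) ^ (d - j)) *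
      ((X - C a) ^ e).coeff (d - j) =
      (-1) ^ e * e.factorial * (derivative^[d - e] f).eval a := by
  conv_rhs => rw [f.as_sum_range' (d + 1) (by omega)]
  rw [iterate_derivative_sum, eval_finsetSum, Finset.mul_sum]
  refine Finset.sum_congr rfl fun j hj => ?_
  have hjd : j ≤ d := Nat.lt_succ_iff.1 (Finset.mem_range.1 hj)
  rw [← C_mul_X_pow_eq_monomial, iterate_derivative_C_mul, iterate_derivative_X_pow_eq_smul,
    sub_eq_add_neg, ← C_neg, coeff_X_add_C_pow]
  simp only [eval_mul, eval_C, eval_smul, eval_pow, eval_X, smul_eq_mul]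
  rcases le_or_gt (d - j) e with h | h
  · obtain ⟨r, hr⟩ := Nat.exists_eq_add_of_le h
    obtain ⟨k, hk⟩ : ∃ k, k = d - j := ⟨_, rfl⟩
    have h1 : e - (d - j) = r := by omega
    have h2 : j = r + (d - e) := by omega
    have h3 : j - (d - e) = r := by omega
    have hfac : (r.factorial : ℝ) * j.descFactorial (d - e) = j.factorial := by
      have := Nat.factorial_mul_descFactorial (n := j) (k := d - e) (by omega)
      rw [h3] at this
      exact_mod_cast this
    have hch : (e.choose (d - j) : ℝ) * (d - j).factorial * r.factorial = e.factorial := by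
      have := Nat.choose_mul_factorial_mul_factorial h
      rw [h1] at this
      exact_mod_cast this
    rw [h1, h3, ← hfac, ← hch]
    have hsign : (-1 : ℝ) ^ e = (-1) ^ (d - j) * (-1) ^ r := by rw [hr, pow_add]
    have hneg : (-a) ^ r = (-1) ^ r * a ^ r := neg_pow a r
    rw [hsign, hneg]
    ring
  · rw [Nat.choose_eq_zero_of_lt h, Nat.descFactorial_of_lt (by omega : j < d - e)]
    simp

/-- Linear independence of shifted powers whose exponents satisfy a Pólya condition that also
counts the successor of each exponent smaller than the maximal degree `d`. -/
theorem linearIndepOn_X_sub_C_pow {ι : Type*} {T : Finset ι} {a : ι → ℝ} {e : ι → ℕ} {d : ℕ}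
    (hinj : Set.InjOn (fun i => (a i, e i)) T) (hd : ∀ i ∈ T, e i ≤ d)
    (hcount : ∀ i ≤ d + 1,
      (T.filter (fun j => e j < i)).card + (T.filter (fun j => e j + 1 < i)).card ≤ i) :
    LinearIndepOn ℝ (fun i => (X - C (a i)) ^ (e i)) (T : Set ι) := by
  classical
  set P : Finset (ℝ × ℕ) := T.image (fun j => (a j, d - e j)) with hP
  obtain ⟨E₀, hPE, hE₀, hEP⟩ := exists_evenGaps_superset P
  have hPd : ∀ x ∈ P, x.2 ≤ d := by
    intro x hx
    obtain ⟨j, _, rfl⟩ := Finset.mem_image.1 hx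
    exact Nat.sub_le _ _
  have hPcount : ∀ m, (P.filter (fun x => m ≤ x.2)).card ≤
      (T.filter (fun j => e j < d + 1 - m)).card := by
    intro m
    refine le_trans (Finset.card_le_card ?_) (Finset.card_image_le (f := fun j => (a j, d - e j)))
    intro x hx
    rw [Finset.mem_filter] at hx
    obtain ⟨j, hj, rfl⟩ := Finset.mem_image.1 hx.1
    have := hd j hj
    exact Finset.mem_image_of_mem _ (Finset.mem_filter.2 ⟨hj, by simp only at hx; omega⟩)
  have hE₀count : ∀ m ≤ d + 1, (E₀.filter (fun x => m ≤ x.2)).card + m ≤ d + 1 := by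
    intro m hm
    have hsub : E₀.filter (fun x => m ≤ x.2) ⊆ P.filter (fun x => m ≤ x.2) ∪
        (P.filter (fun x => m + 1 ≤ x.2)).image (fun x => (x.1, x.2 - 1)) := by
      rintro ⟨b, k⟩ hx
      rw [Finset.mem_filter] at hx
      rw [Finset.mem_union]
      rcases hEP b k hx.1 with h | h
      · exact Or.inl (Finset.mem_filter.2 ⟨h, hx.2⟩)
      · exact Or.inr (Finset.mem_image.2
          ⟨_, Finset.mem_filter.2 ⟨h, Nat.succ_le_succ hx.2⟩, rfl⟩)
    have h1 := (Finset.card_le_card hsub).trans (Finset.card_union_le _ _)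
    have h2 := hPcount m
    have h3 := Finset.card_image_le (s := P.filter (fun x => m + 1 ≤ x.2))
      (f := fun x => (x.1, x.2 - 1))
    have h4 := hPcount (m + 1)
    have h5 := hcount (d + 1 - m) (Nat.sub_le _ _)
    have h6 : T.filter (fun j => e j < d + 1 - (m + 1)) =
        T.filter (fun j => e j + 1 < d + 1 - m) := by
      refine Finset.filter_congr fun j _ => ?_
      omega
    rw [h6] at h4
    omega
  obtain ⟨E, hE₀E, hE, hEcard, hE0⟩ := hE₀.exists_superset_card_eq (d + 1) (by
    have := hE₀count 0 (Nat.zero_le _)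
    simpa using this)
  have hEcount : ∀ m, 0 < m → m ≤ d + 1 → (E.filter (fun x => m ≤ x.2)).card + m ≤ d + 1 := by
    intro m hm hmd
    refine le_trans (Nat.add_le_add_right (Finset.card_le_card ?_) m) (hE₀count m hmd)
    intro x hx
    rw [Finset.mem_filter] at hx ⊢
    refine ⟨(hE0 x hx.1).resolve_right ?_, hx.2⟩
    omega
  let Φ : degreeLT ℝ (d + 1) →ₗ[ℝ] (E → ℝ) :=
    LinearMap.pi fun x => (leval x.1.1).comp ((derivative ^ x.1.2).comp (Submodule.subtype _))
  have hΦ : ∀ f x, Φ f x = (derivative^[x.1.2] (f : ℝ[X])).eval x.1.1 := by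
    intro f x
    simp [Φ, Module.End.pow_apply]
  have hdeg : ∀ f : degreeLT ℝ (d + 1), (f : ℝ[X]).natDegree ≤ d := fun f =>
    natDegree_le_iff_coeff_eq_zero.2 ((degree_lt_iff_coeff_zero _ _).1 (mem_degreeLT.1 f.2))
  have hsurj : Function.Surjective Φ := by
    have : FiniteDimensional ℝ (degreeLT ℝ (d + 1)) :=
      Module.Finite.equiv (degreeLTEquiv ℝ (d + 1)).symm
    refine (LinearMap.injective_iff_surjective_of_finrank_eq_finrank ?_).1 ?_
    · rw [(degreeLTEquiv ℝ (d + 1)).finrank_eq]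
      simp [hEcard]
    · rw [injective_iff_map_eq_zero]
      intro f hf
      refine Subtype.ext (hE.eq_zero_of_isRoot hEcard hEcount (hdeg f) fun x hx => ?_)
      rw [IsRoot.def, ← hΦ f ⟨x, hx⟩, hf]
      rfl
  rw [linearIndepOn_finset_iff]
  intro c hc j₀ hj₀
  have hmem : ∀ j ∈ T, (a j, d - e j) ∈ E := fun j hj =>
    hE₀E (hPE (Finset.mem_image_of_mem _ hj))
  obtain ⟨f, hf⟩ := hsurj (Pi.single ⟨_, hmem j₀ hj₀⟩ 1)
  have hval : ∀ j ∈ T, (derivative^[d - e j] (f : ℝ[X])).eval (a j) = if j = j₀ then 1 else 0 := by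
    intro j hj
    have h1 := hΦ f ⟨_, hmem j hj⟩
    rw [← h1, hf]
    split_ifs with h
    · subst h
      simp
    · rw [Pi.single_eq_of_ne]
      intro heq
      simp only [Subtype.mk.injEq, Prod.mk.injEq] at heq
      refine h (hinj hj hj₀ ?_)
      have := hd j hj
      have := hd j₀ hj₀
      simp only [Prod.mk.injEq]
      exact ⟨heq.1, by omega⟩
  have hpair : ∑ i ∈ T, c i * ((-1) ^ e i * (e i).factorial *
      (derivative^[d - e i] (f : ℝ[X])).eval (a i)) = 0 := by
    have hcoeff : ∀ k, ∑ i ∈ T, c i * ((X - C (a i)) ^ e i).coeff k = 0 := by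
      intro k
      have := congrArg (fun q => coeff q k) hc
      simpa [finsetSum_coeff] using this
    calc _ = ∑ i ∈ T, c i * ∑ j ∈ Finset.range (d + 1), (f : ℝ[X]).coeff j *
          (j.factorial * (d - j).factorial * (-1) ^ (d - j)) *
            ((X - C (a i)) ^ e i).coeff (d - j) := by
          refine Finset.sum_congr rfl fun i hi => ?_
          rw [sum_coeff_mul_coeff_X_sub_C_pow (hd i hi) (a i) (hdeg f)]
      _ = ∑ j ∈ Finset.range (d + 1), (f : ℝ[X]).coeff j *
          (j.factorial * (d - j).factorial * (-1) ^ (d - j)) *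
            ∑ i ∈ T, c i * ((X - C (a i)) ^ e i).coeff (d - j) := by
          simp only [Finset.mul_sum]
          rw [Finset.sum_comm]
          refine Finset.sum_congr rfl fun j _ => Finset.sum_congr rfl fun i _ => ?_
          ring
      _ = 0 := by simp only [hcoeff, mul_zero, Finset.sum_const_zero]
  rw [Finset.sum_eq_single_of_mem j₀ hj₀] at hpair
  · rw [hval j₀ hj₀, if_pos rfl] at hpair
    have hne : ((-1 : ℝ) ^ e j₀ * (e j₀).factorial * 1) ≠ 0 := by
      have := Nat.factorial_ne_zero (e j₀)
      simp [this]
    exact (mul_eq_zero.1 hpair).resolve_right hne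
  · intro j hj hne
    rw [hval j hj, if_neg hne, mul_zero, mul_zero]

theorem card_filter_odd_range (n : ℕ) : ((Finset.range n).filter (fun j => Odd j)).card = n / 2 := by
  induction n with
  | zero => rfl
  | succ n ih =>
    rw [Finset.range_add_one, Finset.filter_insert]
    split_ifs with h
    · rw [Finset.card_insert_of_notMem (by simp), ih]
      obtain ⟨k, rfl⟩ := h
      omega
    · rw [ih]
      obtain ⟨k, rfl⟩ := Nat.not_odd_iff_even.1 h
      omega

/-- In a family of shifted powers sorted by exponent, the members of odd index together with a
member of even index and maximal exponent are linearly independent. -/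
theorem linearIndepOn_insert_odd {s t : ℕ} {a : ℕ → ℝ} {e : ℕ → ℕ}
    (hinj : Set.InjOn (fun i => (a i, e i)) (Finset.range s))
    (hmono : ∀ i j, i ≤ j → j < s → e i ≤ e j) (hpolya : ∀ j < s, j ≤ e j)
    (ht : t < s) (htop : e t = e (s - 1)) :
    LinearIndepOn ℝ (fun i => (X - C (a i)) ^ (e i))
      (insert t ((Finset.range s).filter (fun j => Odd j)) : Finset ℕ) := by
  have hsub : insert t ((Finset.range s).filter (fun j => Odd j)) ⊆ Finset.range s :=
    Finset.insert_subset (Finset.mem_range.2 ht) (Finset.filter_subset _ _)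
  refine linearIndepOn_X_sub_C_pow (d := e (s - 1)) (hinj.mono (Finset.coe_subset.2 hsub)) ?_ ?_
  · intro i hi
    have := Finset.mem_range.1 (hsub hi)
    exact hmono i (s - 1) (by omega) (by omega)
  · have hlow : ∀ i ≤ e (s - 1), ((insert t ((Finset.range s).filter (fun j => Odd j))).filter
        (fun j => e j < i)).card ≤ min i (s - 1) / 2 := by
      intro i hi
      rw [← card_filter_odd_range]
      refine Finset.card_le_card fun j hj => ?_
      simp only [Finset.mem_filter, Finset.mem_insert, Finset.mem_range] at hj ⊢
      obtain ⟨rfl | ⟨hjs, hodd⟩, hlt⟩ := hj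
      · omega
      · have := hpolya j hjs
        have hne : j ≠ s - 1 := by
          rintro rfl
          omega
        exact ⟨by omega, hodd⟩
    intro i hi
    have hs := hpolya (s - 1) (by omega)
    have hsucc : ∀ T : Finset ℕ, T.filter (fun j => e j + 1 < i) = T.filter (fun j => e j < i - 1) :=
      fun T => Finset.filter_congr fun j _ => by omega
    rw [hsucc]
    have h2 := hlow (i - 1) (by omega)
    rcases hi.lt_or_eq with hlt | rfl
    · have h1 := hlow i (by omega)
      omega
    · have h1 := (Finset.card_filter_le (insert t ((Finset.range s).filter (fun j => Odd j)))
        (fun j => e j < e (s - 1) + 1)).trans (Finset.card_insert_le _ _)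
      rw [card_filter_odd_range] at h1
      omega

theorem card_insert_filter_odd_range {s t : ℕ} (ht : Even t) :
    (insert t ((Finset.range s).filter (fun j => Odd j))).card = s / 2 + 1 := by
  rw [Finset.card_insert_of_notMem, card_filter_odd_range]
  simp [ht]

/-- A family of shifted powers sorted by exponent and satisfying the Pólya condition has a linearly
independent subfamily comprising more than half of its members. -/
theorem exists_linearIndepOn_of_sorted {s : ℕ} (hs : 0 < s) {a : ℕ → ℝ} {e : ℕ → ℕ}
    (hinj : Set.InjOn (fun i => (a i, e i)) (Finset.range s))
    (hmono : ∀ i j, i ≤ j → j < s → e i ≤ e j) (hpolya : ∀ j < s, j ≤ e j) :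
    ∃ T : Finset ℕ, T ⊆ Finset.range s ∧ T.card = s / 2 + 1 ∧
      LinearIndepOn ℝ (fun i => (X - C (a i)) ^ (e i)) (T : Set ℕ) := by
  have hsub : ∀ r t, r ≤ s → t < r →
      insert t ((Finset.range r).filter (fun j => Odd j)) ⊆ Finset.range s := fun r t hr ht =>
    (Finset.insert_subset (Finset.mem_range.2 ht) (Finset.filter_subset _ _)).trans
      (Finset.range_mono hr)
  rcases Nat.even_or_odd' s with ⟨k, rfl | rfl⟩
  · by_cases htop : e (2 * k - 2) = e (2 * k - 1)
    · exact ⟨_, hsub (2 * k) (2 * k - 2) le_rfl (by omega),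
        card_insert_filter_odd_range ⟨k - 1, by omega⟩,
        linearIndepOn_insert_odd hinj hmono hpolya (by omega) htop⟩
    · have hlt : e (2 * k - 2) < e (2 * k - 1) :=
        (hmono _ _ (by omega) (by omega)).lt_of_ne htop
      set T := insert (2 * k - 2) ((Finset.range (2 * k - 1)).filter (fun j => Odd j)) with hT
      have hTs : T ⊆ Finset.range (2 * k - 1) :=
        Finset.insert_subset (Finset.mem_range.2 (by omega)) (Finset.filter_subset _ _)
      have hind : LinearIndepOn ℝ (fun i => (X - C (a i)) ^ (e i)) (T : Set ℕ) :=
        linearIndepOn_insert_odd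
          (hinj.mono (Finset.coe_subset.2 (Finset.range_mono (Nat.sub_le _ _))))
          (fun i j hij hj => hmono i j hij (by omega)) (fun j hj => hpolya j (by omega))
          (by omega) (by congr 1)
      refine ⟨insert (2 * k - 1) T, Finset.insert_subset (Finset.mem_range.2 (by omega))
        (hTs.trans (Finset.range_mono (Nat.sub_le _ _))), ?_, ?_⟩
      · rw [Finset.card_insert_of_notMem, hT, card_insert_filter_odd_range ⟨k - 1, by omega⟩]
        · omega
        · intro h
          simpa using hTs h
      · rw [Finset.coe_insert]
        refine hind.insert fun hmem => ?_
        have hle : Submodule.span ℝ ((fun i => (X - C (a i)) ^ (e i)) '' (T : Set ℕ)) ≤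
            degreeLT ℝ (e (2 * k - 1)) := by
          rw [Submodule.span_le]
          rintro _ ⟨j, hj, rfl⟩
          have hj' := Finset.mem_range.1 (hTs hj)
          have := hmono j (2 * k - 2) (by omega) (by omega)
          rw [SetLike.mem_coe, mem_degreeLT, degree_pow, degree_X_sub_C, nsmul_one]
          exact_mod_cast this.trans_lt hlt
        have := mem_degreeLT.1 (hle hmem)
        rw [degree_pow, degree_X_sub_C, nsmul_one] at this
        exact lt_irrefl _ this
  · exact ⟨_, hsub (2 * k + 1) (2 * k) le_rfl (by omega),
      card_insert_filter_odd_range (even_two_mul k),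
      linearIndepOn_insert_odd hinj hmono hpolya (by omega) rfl⟩

theorem stmt17 (s : ℕ) (hs : 0 < s) (a : Fin s → ℝ) (e : Fin s → ℕ)
    (hdist : Function.Injective (fun i => (a i, e i)))
    (hpolya : ∀ i : ℕ, (Finset.univ.filter (fun j => e j < i)).card ≤ i) :
    s / 2 + 1 ≤
      Module.finrank ℝ
        (Submodule.span ℝ (Set.range fun i => (X - C (a i)) ^ (e i))) := by
  set σ := Tuple.sort e
  have hσ : Monotone (e ∘ σ) := Tuple.monotone_sort e
  let idx : ℕ → Fin s := fun n => σ ⟨min n (s - 1), by omega⟩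
  have hidx : ∀ n (hn : n < s), idx n = σ ⟨n, hn⟩ := fun n hn =>
    congrArg σ (Fin.ext (min_eq_left (by omega)))
  have hmono : ∀ i j, i ≤ j → j < s → e (idx i) ≤ e (idx j) := fun i j hij hj =>
    hσ (Fin.mk_le_mk.2 (min_le_min_right _ hij))
  have hidxinj : Set.InjOn idx (Finset.range s) := by
    intro i hi j hj hij
    rw [Finset.coe_range, Set.mem_Iio] at hi hj
    rw [hidx i hi, hidx j hj] at hij
    exact Fin.mk.inj_iff.1 (σ.injective hij)
  have hpol : ∀ j < s, j ≤ e (idx j) := by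
    intro j hj
    have h1 : (Finset.range (j + 1)).image idx ⊆
        Finset.univ.filter (fun i => e i < e (idx j) + 1) := by
      intro i hi
      obtain ⟨l, hl, rfl⟩ := Finset.mem_image.1 hi
      rw [Finset.mem_range] at hl
      exact Finset.mem_filter.2
        ⟨Finset.mem_univ _, Nat.lt_succ_of_le (hmono l j (by omega) hj)⟩
    have h2 := (Finset.card_le_card h1).trans (hpolya _)
    rw [Finset.card_image_of_injOn (hidxinj.mono
      (Finset.coe_subset.2 (Finset.range_mono hj))), Finset.card_range] at h2
    omega
  obtain ⟨T, hTs, hTcard, hT⟩ := exists_linearIndepOn_of_sorted hs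
    (a := a ∘ idx) (e := e ∘ idx) (hdist.comp_injOn hidxinj) hmono hpol
  have hcard := finrank_span_eq_card hT.linearIndependent
  simp only [Finset.coe_sort_coe, Fintype.card_coe, hTcard] at hcard
  rw [← hcard]
  have : FiniteDimensional ℝ (Submodule.span ℝ (Set.range fun i => (X - C (a i)) ^ (e i))) :=
    FiniteDimensional.span_of_finite ℝ (Set.finite_range _)
  refine Submodule.finrank_mono (Submodule.span_mono ?_)
  rintro _ ⟨j, rfl⟩
  exact ⟨idx j, rfl⟩
end
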